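/- For every x²-divisible polynomial g ∈ ℤ[x] of degree d ≥ 3, there exists a constant M_g > 0, depending only on g and not on c, such that for every c ∈ S_g the Zsigmondy set Z(g_c, 0) has cardinality at most M_g. -/

import Mathlib

open Polynomial

/-- The `n`-th iterate of `g_c := g + c` applied to `0`, for `g ∈ ℤ[x]` and `c ∈ ℚ`. -/
noncomputable def gcIter (g : ℤ[X]) (c : ℚ) (n : ℕ) : ℚ :=
  (fun x : ℚ => (g.map (Int.castRingHom ℚ)).eval x + c)^[n] 0

/-- `g` is `x²`-divisible: degree at least 2 and zero constant and linear coefficients. -/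
def IsX2Divisible (g : ℤ[X]) : Prop :=
  2 ≤ g.natDegree ∧ g.coeff 0 = 0 ∧ g.coeff 1 = 0

/-- The length `L_g = 1 + ∑_{i=2}^{d-1} |u_i|/|u_d|` of an `x²`-divisible polynomial. -/
noncomputable def Lg (g : ℤ[X]) : ℝ :=
  1 + ∑ i ∈ Finset.Ico 2 g.natDegree, (|g.coeff i| : ℝ) / (|g.leadingCoeff| : ℝ)

/-- `S_g`: the set of `c ∈ ℚ` such that the sequence `{g_c^n(0)}_{n ≥ 1}` takes
infinitely many values. -/
def Sg (g : ℤ[X]) : Set ℚ :=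
  {c : ℚ | (Set.range fun n : ℕ => gcIter g c (n + 1)).Infinite}

/-- The numerator `A_n` of `g_c^{n+1}(0) = g_c^n(c) = A_n / B_n` in lowest terms. -/
noncomputable def An (g : ℤ[X]) (c : ℚ) (n : ℕ) : ℤ := (gcIter g c (n + 1)).num

/-- The (positive) denominator `B_n` of `g_c^{n+1}(0) = g_c^n(c) = A_n / B_n`
in lowest terms. -/
noncomputable def Bn (g : ℤ[X]) (c : ℚ) (n : ℕ) : ℕ := (gcIter g c (n + 1)).den

/-- For a natural number `a`, the factor `â = ∏_{p ∈ I(a)} p^{val_p(a)}`, where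
`I(a)` consists of the primes `p` with `val_p(a) > val_p(u_d)`. -/
noncomputable def hatB (g : ℤ[X]) (a : ℕ) : ℕ :=
  ∏ p ∈ a.primeFactors.filter
      (fun p => padicValInt p g.leadingCoeff < padicValNat p a),
    p ^ padicValNat p a

/-- `g` has rapidly increasing numerators on `S`: there is an integer `N > 0` such that
for every `c ∈ S` there is a finite set `J_c ⊆ ℕ` with `#J_c ≤ N` such that for every
`n ≥ 1` outside `J_c` one has `ln |A_n| > ∑_{p ∣ n} ln |A_{n/p}|`. -/
def RapidlyIncreasingNumerators (g : ℤ[X]) (S : Set ℚ) : Prop :=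
  ∃ N : ℕ, 0 < N ∧ ∀ c ∈ S, ∃ J : Finset ℕ, J.card ≤ N ∧
    ∀ n : ℕ, 1 ≤ n → n ∉ J →
      (∑ p ∈ n.primeFactors, Real.log |(An g c (n / p) : ℝ)|) <
        Real.log |(An g c n : ℝ)|

/-- A prime `p` is a primitive prime divisor of `g_c^n(0)` if `val_p(g_c^n(0)) > 0`
and `val_p(g_c^k(0)) ≤ 0` for all `1 ≤ k < n`. -/
def HasPrimitivePrimeDivisor (g : ℤ[X]) (c : ℚ) (n : ℕ) : Prop :=
  ∃ p : ℕ, p.Prime ∧ 0 < padicValRat p (gcIter g c n) ∧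
    ∀ k : ℕ, 1 ≤ k → k < n → padicValRat p (gcIter g c k) ≤ 0

/-- The Zsigmondy set `Z(g_c, 0)` of the sequence `{g_c^n(0)}_{n ≥ 1}`. -/
def Zsig (g : ℤ[X]) (c : ℚ) : Set ℕ :=
  {n : ℕ | 1 ≤ n ∧ ¬ HasPrimitivePrimeDivisor g c n}


open Filter in
lemma exists_forall_mul_succ_lt_mul_pow {b : ℝ} (hb : 1 < b) (A : ℝ) {B : ℝ} (hB : 0 < B) :
    ∃ n₀ : ℕ, ∀ n ≥ n₀, A * (n + 1) < B * b ^ n := by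
  have h : Tendsto (fun n : ℕ => A * ((n : ℝ) / b ^ n + 1 / b ^ n)) atTop (nhds (A * (0 + 0))) := by
    refine Tendsto.const_mul _ (Tendsto.add ?_ ?_)
    · simpa using tendsto_pow_const_div_const_pow_of_one_lt 1 hb
    · simpa using tendsto_pow_const_div_const_pow_of_one_lt 0 hb
  have h' := h.eventually_lt_const (u := B) (by simpa using hB)
  obtain ⟨n₀, hn₀⟩ := eventually_atTop.1 h'
  refine ⟨n₀, fun n hn => ?_⟩
  have hbn : 0 < b ^ n := by positivity
  have := hn₀ n hn
  rw [← add_div, ← mul_div_assoc, div_lt_iff₀ hbn] at this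
  exact this

lemma gcIter_zero (g : ℤ[X]) (c : ℚ) : gcIter g c 0 = 0 := rfl

lemma gcIter_succ (g : ℤ[X]) (c : ℚ) (n : ℕ) :
    gcIter g c (n + 1) = (g.map (Int.castRingHom ℚ)).eval (gcIter g c n) + c :=
  Function.iterate_succ_apply' _ _ _

lemma IsX2Divisible.X_sq_dvd {g : ℤ[X]} (hg : IsX2Divisible g) : X ^ 2 ∣ g := by
  rw [X_pow_dvd_iff]
  intro d hd
  interval_cases d
  exacts [hg.2.1, hg.2.2]

lemma IsX2Divisible.ne_zero {g : ℤ[X]} (hg : IsX2Divisible g) : g ≠ 0 := by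
  rintro rfl
  simpa using hg.1

lemma gcIter_one {g : ℤ[X]} (hg : IsX2Divisible g) (c : ℚ) : gcIter g c 1 = c := by
  rw [gcIter_succ, gcIter_zero]
  simp [← coeff_zero_eq_eval_zero, hg.2.1]

section AbsoluteValue

variable (v : AbsoluteValue ℚ ℝ)

lemma exists_forall_abv_eval_le (p : ℚ[X]) (B : ℝ) :
    ∃ C, 0 ≤ C ∧ ∀ x, v x ≤ B → v (p.eval x) ≤ C := by
  induction p using Polynomial.induction_on' with
  | add p q hp hq =>
    obtain ⟨C, hC, hp⟩ := hp
    obtain ⟨D, hD, hq⟩ := hq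
    refine ⟨C + D, by positivity, fun x hx => ?_⟩
    rw [eval_add]
    exact (v.add_le _ _).trans (add_le_add (hp x hx) (hq x hx))
  | monomial n a =>
    refine ⟨v a * |B| ^ n, by positivity, fun x hx => ?_⟩
    rw [eval_monomial, map_mul, map_pow]
    gcongr
    exact hx.trans (le_abs_self B)

lemma exists_forall_abv_eval_sub_eval_le (p : ℚ[X]) (B : ℝ) :
    ∃ C, 0 ≤ C ∧ ∀ x y, v x ≤ B → v y ≤ B → v (p.eval x - p.eval y) ≤ C * v (x - y) := by
  induction p using Polynomial.induction_on with
  | C a => exact ⟨0, le_rfl, fun x y _ _ => by simp⟩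
  | add p q hp hq =>
    obtain ⟨C, hC, hp⟩ := hp
    obtain ⟨D, hD, hq⟩ := hq
    refine ⟨C + D, by positivity, fun x y hx hy => ?_⟩
    rw [eval_add, eval_add, add_sub_add_comm, add_mul]
    exact (v.add_le _ _).trans (add_le_add (hp x y hx hy) (hq x y hx hy))
  | monomial n a ih =>
    obtain ⟨C, hC, ih⟩ := ih
    obtain ⟨D, hD, hb⟩ := exists_forall_abv_eval_le v (Polynomial.C a * X ^ n) B
    refine ⟨C * |B| + D, by positivity, fun x y hx hy => ?_⟩
    set q : ℚ[X] := Polynomial.C a * X ^ n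
    have hq : Polynomial.C a * X ^ (n + 1) = q * X := by simp only [q]; ring
    rw [hq, eval_mul_X, eval_mul_X, show q.eval x * x - q.eval y * y
        = (q.eval x - q.eval y) * x + q.eval y * (x - y) by ring]
    refine (v.add_le _ _).trans ?_
    rw [map_mul, map_mul, add_mul]
    have h1 := ih x y hx hy
    have h2 := hb y hy
    have h3 : v x ≤ |B| := hx.trans (le_abs_self B)
    have h4 : 0 ≤ v (x - y) := v.nonneg _
    calc v (q.eval x - q.eval y) * v x + v (q.eval y) * v (x - y)
        ≤ (C * v (x - y)) * |B| + D * v (x - y) := by gcongr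
      _ = _ := by ring

open Filter in
lemma exists_forall_two_mul_abv_le_abv_eval {p : ℚ[X]} (hp : 2 ≤ p.natDegree)
    (h0 : p.coeff 0 = 0) :
    ∃ R : ℝ, 1 ≤ R ∧ ∀ x, R ≤ v x → 2 * v x ≤ v (p.eval x) := by
  have hdeg : p.divX.natDegree = p.natDegree - 1 := natDegree_divX_eq_natDegree_tsub_one
  have hpos : 0 < p.divX.degree := natDegree_pos_iff_degree_pos.1 (by omega)
  have hX : p = p.divX * X := by
    conv_lhs => rw [← divX_mul_X_add p, h0]
    simp
  have ht := tendsto_abv_atTop v p.divX hpos (l := comap v atTop) (z := id) tendsto_comap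
  obtain ⟨s, hs, hsub⟩ := mem_comap.1 (ht.eventually_ge_atTop 2)
  obtain ⟨R, hR⟩ := mem_atTop_sets.1 hs
  refine ⟨max R 1, le_max_right _ _, fun x hx => ?_⟩
  have h2 : 2 ≤ v (p.divX.eval x) := hsub (hR (v x) ((le_max_left _ _).trans hx))
  rw [hX, eval_mul, eval_X, map_mul]
  gcongr

/-- An orbit of `0` which comes very close to `0` stays away from `0` at the scale of its
closest previous approach. -/
lemma exists_abv_gcIter_div_two_le {g : ℤ[X]} (hg : IsX2Divisible g) :
    ∃ C : ℝ, 1 ≤ C ∧ ∀ (c : ℚ) (N : ℕ), 1 ≤ N → C ^ N * v (gcIter g c N) < 1 →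
      ∃ n, 1 ≤ n ∧ n ≤ N ∧ ∀ m, 1 ≤ m → v (gcIter g c n) / 2 ≤ v (gcIter g c m) := by
  set G : ℚ[X] := g.map (Int.castRingHom ℚ) with hG
  have hdeg : G.natDegree = g.natDegree :=
    natDegree_map_eq_of_injective (RingHom.injective_int _) _
  obtain ⟨R, hR1, hR⟩ := exists_forall_two_mul_abv_le_abv_eval v (p := G)
    (hdeg ▸ hg.1) (by simp [hG, hg.2.1])
  obtain ⟨L, hL0, hL⟩ := exists_forall_abv_eval_sub_eval_le v G (R + 1)
  obtain ⟨q, hq⟩ := hg.X_sq_dvd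
  obtain ⟨D, hD0, hD⟩ := exists_forall_abv_eval_le v (q.map (Int.castRingHom ℚ)) 1
  have hquad : ∀ x, v x ≤ 1 → v (G.eval x) ≤ D * v x ^ 2 := by
    intro x hx
    rw [hG, hq, Polynomial.map_mul, eval_mul, map_mul, mul_comm]
    simp only [Polynomial.map_pow, map_X, eval_pow, eval_X, map_pow]
    gcongr
    exact hD x hx
  set C : ℝ := L + D + 1 with hC
  have hC1 : 1 ≤ C := by linarith
  refine ⟨8 * C, by linarith, fun c N hN hsmall => ?_⟩
  obtain ⟨n, hn, hmin⟩ := Finset.exists_min_image (Finset.Icc 1 N)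
    (fun j => v (gcIter g c j)) ⟨1, by simp [hN]⟩
  rw [Finset.mem_Icc] at hn
  refine ⟨n, hn.1, hn.2, ?_⟩
  set a : ℕ → ℚ := gcIter g c with ha
  set μ := v (a n) with hμ
  have hμ0 : 0 ≤ μ := v.nonneg _
  have hNμ : μ ≤ v (a N) := hmin N (by simp [hN])
  have h8 : 8 * (C ^ n * μ) < 1 := by
    refine lt_of_le_of_lt ?_ hsmall
    rw [mul_pow, ← mul_assoc]
    gcongr
    · calc (8 : ℝ) = 8 ^ 1 := (pow_one _).symm
        _ ≤ 8 ^ N := pow_le_pow_right₀ (by norm_num) hN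
    · exact hn.2
  have h8μ : 8 * μ < 1 := by
    have : 1 * μ ≤ C ^ n * μ := by
      gcongr
      exact one_le_pow₀ hC1
    linarith
  have hsucc : ∀ j, a (j + 1) = G.eval (a j) + c := gcIter_succ g c
  have hbdd : ∀ i, i ≤ n → v (a i) ≤ R := by
    by_contra! h
    obtain ⟨i, hin, hi⟩ := h
    have hi0 : i ≠ 0 := by
      rintro rfl
      simp [ha, gcIter_zero] at hi
      linarith
    have hgrow : ∃ ρ, 1 ≤ ρ ∧ ∀ m, i ≤ m → ρ ≤ v (a m) := by
      rcases le_total (v c) R with hc | hc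
      · refine ⟨R, hR1, fun m hm => ?_⟩
        induction m, hm using Nat.le_induction with
        | base => exact hi.le
        | succ m hm ih =>
          rw [hsucc]
          have h1 := hR _ ih
          have h2 := v.le_add (G.eval (a m)) c
          linarith
      · refine ⟨v c, hR1.trans hc, fun m hm => ?_⟩
        have h1m : 1 ≤ m := by omega
        clear hm
        induction m, h1m using Nat.le_induction with
        | base => rw [ha, gcIter_one hg]
        | succ m hm ih =>
          rw [hsucc]
          have h1 := hR _ (hc.trans ih)
          have h2 := v.le_add (G.eval (a m)) c
          linarith
    obtain ⟨ρ, hρ, h⟩ := hgrow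
    have := h n hin
    linarith
  set f : ℚ → ℚ := fun x => G.eval x + c with hf
  have haf : ∀ j, a j = f^[j] 0 := fun _ => rfl
  have hdisc : ∀ x, v x ≤ 2 * μ → ∀ j ≤ n, C ^ j * v x ^ 2 ≤ μ / 2 := by
    intro x hx j hjn
    have h0 : 0 ≤ v x := v.nonneg x
    calc C ^ j * v x ^ 2 ≤ C ^ n * (2 * μ) ^ 2 := by gcongr
      _ = (8 * (C ^ n * μ)) * (μ / 2) := by ring
      _ ≤ 1 * (μ / 2) := by gcongr
      _ = μ / 2 := one_mul _
  have hclose : ∀ x, v x ≤ 2 * μ → ∀ j, 1 ≤ j → j ≤ n →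
      v (f^[j] x - a j) ≤ C ^ j * v x ^ 2 := by
    intro x hx j hj
    induction j, hj using Nat.le_induction with
    | base =>
      intro _
      have h1 : f^[1] x - a 1 = G.eval x := by
        rw [ha, gcIter_one hg]
        simp [hf]
      rw [h1, pow_one]
      refine (hquad x (by linarith)).trans ?_
      gcongr
      linarith
    | succ j hj ih =>
      intro hjn
      have ih := ih (by omega)
      have h1 : f^[j + 1] x - a (j + 1) = G.eval (f^[j] x) - G.eval (a j) := by
        rw [Function.iterate_succ_apply', hsucc]
        simp [hf]
      have haj := hbdd j (by omega)
      have hd := hdisc x hx j (by omega)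
      have h2 : v (f^[j] x) ≤ R + 1 := by
        have := v.le_sub (f^[j] x) (a j)
        linarith
      rw [h1]
      refine (hL _ _ h2 (by linarith)).trans ?_
      calc L * v (f^[j] x - a j) ≤ C * (C ^ j * v x ^ 2) := by
            gcongr
            linarith
        _ = C ^ (j + 1) * v x ^ 2 := by ring
  have hnear : ∀ x, v x ≤ 2 * μ → ∀ j, 1 ≤ j → j ≤ n → v (f^[j] x - a j) ≤ μ / 2 :=
    fun x hx j hj hjn => (hclose x hx j hj hjn).trans (hdisc x hx j hjn)
  have hper : ∀ k, v (a (n * k)) ≤ 2 * μ := by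
    intro k
    induction k with
    | zero => simpa [ha, gcIter_zero]
    | succ k ih =>
      have h1 := hnear _ ih n hn.1 le_rfl
      have h2 : a (n * (k + 1)) = f^[n] (a (n * k)) := by
        rw [haf, haf, ← Function.iterate_add_apply]
        congr 2
        ring
      rw [h2]
      have := v.le_sub (f^[n] (a (n * k))) (a n)
      linarith
  intro m hm
  have hlt : (m - 1) % n < n := Nat.mod_lt _ hn.1
  have hdm := Nat.div_add_mod (m - 1) n
  have h1 := hnear _ (hper ((m - 1) / n)) ((m - 1) % n + 1) (by omega) hlt
  have h2 : f^[(m - 1) % n + 1] (a (n * ((m - 1) / n))) = a m := by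
    rw [haf, haf, ← Function.iterate_add_apply]
    congr 2
    omega
  rw [h2, v.map_sub] at h1
  have h3 : μ ≤ v (a ((m - 1) % n + 1)) := hmin _ (by rw [Finset.mem_Icc]; omega)
  have := v.le_sub (a ((m - 1) % n + 1)) (a m)
  linarith

/-- Outside a set of uniformly bounded size, the terms of the orbit are not exceptionally close
to `0`. -/
lemma exists_card_le_forall_exp_le_abv_gcIter {g : ℤ[X]} (hg : IsX2Divisible g) {b : ℝ}
    (hb : 1 < b) (K : ℝ) {δ : ℝ} (hδ : 0 < δ) :
    ∃ M : ℕ, ∀ (c : ℚ) (T : ℝ), 1 ≤ T →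
      (∀ n, 1 ≤ n → Real.exp (-(K * b ^ n * T)) ≤ v (gcIter g c n)) →
      ∃ F : Finset ℕ, F.card ≤ M ∧
        ∀ n, 1 ≤ n → n ∉ F → Real.exp (-(δ * b ^ n * T)) ≤ v (gcIter g c n) := by
  obtain ⟨C, hC1, hC⟩ := exists_abv_gcIter_div_two_le v hg
  obtain ⟨n₀, hn₀⟩ := exists_forall_mul_succ_lt_mul_pow hb (Real.log C) hδ
  obtain ⟨r, hr⟩ := pow_unbounded_of_one_lt ((|K| + 1) / δ) hb
  refine ⟨n₀ + (r + 1), fun c T hT hlow => ?_⟩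
  by_cases hex : ∃ N, n₀ ≤ N ∧ 1 ≤ N ∧ v (gcIter g c N) < Real.exp (-(δ * b ^ N * T))
  · classical
    set N := Nat.find hex with hNdef
    obtain ⟨hN0, hN1, hN⟩ := Nat.find_spec hex
    have hmin : ∀ m < N, ¬(n₀ ≤ m ∧ 1 ≤ m ∧ v (gcIter g c m) < Real.exp (-(δ * b ^ m * T))) :=
      fun m hm => Nat.find_min hex hm
    rw [← hNdef] at hN0 hN1 hN
    have hbN : 1 ≤ b ^ N := one_le_pow₀ hb.le
    have hsmall : C ^ N * v (gcIter g c N) < 1 := by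
      have hC0 : 0 < C := by linarith
      have h1 : C ^ N = Real.exp (N * Real.log C) := by
        rw [mul_comm, Real.exp_mul, Real.exp_log hC0, Real.rpow_natCast]
      have h2 : N * Real.log C ≤ δ * b ^ N * T := by
        have h3 := hn₀ N hN0
        have h4 : 0 ≤ Real.log C := Real.log_nonneg hC1
        have h5 : δ * b ^ N * 1 ≤ δ * b ^ N * T := by gcongr
        linarith
      calc C ^ N * v (gcIter g c N) < C ^ N * Real.exp (-(δ * b ^ N * T)) := by gcongr
        _ = Real.exp (N * Real.log C + -(δ * b ^ N * T)) := by rw [h1, Real.exp_add]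
        _ ≤ 1 := by
          rw [Real.exp_le_one_iff]
          linarith
    obtain ⟨n, hn1, hnN, hn⟩ := hC c N hN1 hsmall
    refine ⟨Finset.range n₀ ∪ Finset.Icc N (N + r), ?_, fun m hm hmF => ?_⟩
    · refine (Finset.card_union_le _ _).trans ?_
      simp only [Finset.card_range, Nat.card_Icc]
      omega
    · simp only [Finset.mem_union, Finset.mem_range, Finset.mem_Icc, not_or, not_and, not_lt,
        not_le] at hmF
      rcases lt_or_ge m N with hmN | hmN
      · have := hmin m hmN
        push Not at this
        exact this hmF.1 hm
      · have hmr := hmF.2 hmN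
        have hKK : K ≤ |K| := le_abs_self K
        have hbT : 1 ≤ b ^ N * T := by nlinarith
        have h1 : K * b ^ n * T ≤ |K| * b ^ N * T := by
          have hb0 : (0 : ℝ) ≤ b ^ n := by positivity
          have : b ^ n ≤ b ^ N := pow_le_pow_right₀ hb.le hnN
          gcongr
        have h2 : (|K| + 1) * (b ^ N * T) ≤ δ * b ^ m * T := by
          rw [div_lt_iff₀ hδ] at hr
          have hb0 : (0 : ℝ) ≤ b ^ N * T := by linarith
          calc (|K| + 1) * (b ^ N * T) ≤ (b ^ r * δ) * (b ^ N * T) := by gcongr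
            _ = δ * b ^ (N + r) * T := by ring
            _ ≤ δ * b ^ m * T := by
              have : b ^ (N + r) ≤ b ^ m := pow_le_pow_right₀ hb.le hmr.le
              gcongr
        have h3 : Real.exp (-1) ≤ 1 / 2 := by
          rw [Real.exp_neg, ← one_div]
          have := Real.add_one_le_exp (1 : ℝ)
          gcongr
          linarith
        have h4 := hlow n hn1
        have h5 := hn m hm
        calc Real.exp (-(δ * b ^ m * T)) ≤ Real.exp (-(K * b ^ n * T) + -1) := by
              apply Real.exp_le_exp.2
              nlinarith
          _ = Real.exp (-(K * b ^ n * T)) * Real.exp (-1) := Real.exp_add _ _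
          _ ≤ v (gcIter g c n) * (1 / 2) := by gcongr
          _ ≤ v (gcIter g c m) := by linarith
  · push Not at hex
    refine ⟨Finset.range n₀, by simp, fun n hn hnF => hex n ?_ hn⟩
    simpa using hnF

end AbsoluteValue

section Height

open Height

lemma exists_max_one_abs_eval_bounds {g : ℤ[X]} (hg : g ≠ 0) :
    ∃ A : ℝ, 1 ≤ A ∧ ∀ x : ℚ,
      max 1 |(((g.map (Int.castRingHom ℚ)).eval x : ℚ) : ℝ)| ≤ A * max 1 |(x : ℝ)| ^ g.natDegree ∧
      max 1 |(x : ℝ)| ^ g.natDegree ≤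
        A * max 1 |(((g.map (Int.castRingHom ℚ)).eval x : ℚ) : ℝ)| := by
  set G : ℚ[X] := g.map (Int.castRingHom ℚ) with hG
  have hdeg : G.natDegree = g.natDegree :=
    natDegree_map_eq_of_injective (RingHom.injective_int _) _
  obtain ⟨L, hL0, hL⟩ := exists_forall_abv_eval_sub_eval_le Rat.AbsoluteValue.real G.reverse 1
  simp only [Rat.AbsoluteValue.real_eq_abs, Rat.cast_abs] at hL
  have hu : (1 : ℝ) ≤ |((G.leadingCoeff : ℚ) : ℝ)| := by
    rw [hG, leadingCoeff_map_of_injective (RingHom.injective_int _)]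
    have : (1 : ℤ) ≤ |g.leadingCoeff| := Int.one_le_abs (leadingCoeff_ne_zero.2 hg)
    simpa using (by exact_mod_cast this : (1 : ℝ) ≤ ((|g.leadingCoeff| : ℤ) : ℝ))
  set S : ℝ := ∑ i ∈ Finset.range (g.natDegree + 1), |((G.coeff i : ℚ) : ℝ)| with hS
  have hS0 : 0 ≤ S := Finset.sum_nonneg fun _ _ => abs_nonneg _
  set R : ℝ := 1 + 2 * L with hR
  have hRd : 1 ≤ R ^ g.natDegree := one_le_pow₀ (by linarith)
  refine ⟨S + 2 * R ^ g.natDegree, by linarith, fun x => ?_⟩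
  set t : ℝ := max 1 |(x : ℝ)| with ht
  have ht1 : 1 ≤ t := le_max_left _ _
  have htd : 1 ≤ t ^ g.natDegree := one_le_pow₀ ht1
  set s : ℝ := max 1 |((G.eval x : ℚ) : ℝ)| with hs
  have hs1 : 1 ≤ s := le_max_left _ _
  constructor
  · have hup : |((G.eval x : ℚ) : ℝ)| ≤ S * t ^ g.natDegree := by
      rw [eval_eq_sum_range, hdeg, Rat.cast_sum, hS, Finset.sum_mul]
      refine (Finset.abs_sum_le_sum_abs _ _).trans (Finset.sum_le_sum fun i hi => ?_)
      rw [Rat.cast_mul, Rat.cast_pow, abs_mul, abs_pow]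
      gcongr
      calc |(x : ℝ)| ^ i ≤ t ^ i := by
            gcongr
            exact le_max_right _ _
        _ ≤ t ^ g.natDegree := pow_le_pow_right₀ ht1 (by simpa [Nat.lt_succ_iff] using hi)
    rw [add_mul]
    refine max_le ?_ ?_
    · nlinarith [mul_nonneg hS0 (zero_le_one.trans htd)]
    · nlinarith
  · rcases le_total |(x : ℝ)| R with hxR | hxR
    · have h1 : t ^ g.natDegree ≤ R ^ g.natDegree := by
        gcongr
        exact max_le (by linarith) hxR
      nlinarith
    · have hx1 : 1 ≤ |(x : ℝ)| := by linarith
      have htx : t = |(x : ℝ)| := max_eq_right hx1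
      have hx0 : x ≠ 0 := by
        rintro rfl
        norm_num at hx1
      have hrev : G.eval x = G.reverse.eval x⁻¹ * x ^ g.natDegree := by
        have hinv : Invertible x := invertibleOfNonzero hx0
        have h := eval₂_reverse_mul_pow (RingHom.id ℚ) x G
        rw [hdeg, invOf_eq_inv] at h
        exact h.symm
      have hxi : |((x⁻¹ : ℚ) : ℝ)| ≤ 1 := by
        rw [Rat.cast_inv, abs_inv]
        exact inv_le_one_of_one_le₀ hx1
      have h0 := hL x⁻¹ 0 hxi (by simp)
      rw [← coeff_zero_eq_eval_zero, coeff_zero_reverse, sub_zero] at h0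
      have h1 : L * |((x⁻¹ : ℚ) : ℝ)| ≤ 1 / 2 := by
        rw [Rat.cast_inv, abs_inv, ← div_eq_mul_inv, div_le_iff₀ (by linarith)]
        linarith
      have h2 : 1 / 2 ≤ |((G.reverse.eval x⁻¹ : ℚ) : ℝ)| := by
        rw [Rat.cast_sub, abs_sub_comm] at h0
        have := abs_sub_abs_le_abs_sub ((G.leadingCoeff : ℚ) : ℝ) ((G.reverse.eval x⁻¹ : ℚ) : ℝ)
        linarith
      have h3 : t ^ g.natDegree ≤ 2 * s := by
        have h4 : |((G.eval x : ℚ) : ℝ)| ≤ s := le_max_right _ _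
        rw [hrev, Rat.cast_mul, Rat.cast_pow, abs_mul, abs_pow, ← htx] at h4
        nlinarith
      nlinarith [mul_nonneg hS0 (zero_le_one.trans hs1)]

lemma mulHeight₁_rat_eq (x : ℚ) : mulHeight₁ x = x.den * max 1 |(x : ℝ)| := by
  have hd : (0 : ℝ) < x.den := by exact_mod_cast x.pos
  rw [Rat.mulHeight₁_eq_max, mul_max_of_nonneg _ _ hd.le, mul_one, max_comm]
  rw [Rat.cast_def x, abs_div, Nat.abs_cast, mul_div_cancel₀ _ hd.ne']
  push_cast [Nat.cast_natAbs]
  rfl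

lemma dvd_eval_scaleRoots_sub {g : ℤ[X]} (a b : ℤ) :
    b ∣ (g.scaleRoots b).eval a - g.leadingCoeff * a ^ g.natDegree := by
  rw [eval_eq_sum_range, natDegree_scaleRoots, Finset.sum_range_succ, coeff_scaleRoots_natDegree,
    add_sub_cancel_right]
  refine Finset.dvd_sum fun i hi => ?_
  rw [Finset.mem_range] at hi
  rw [coeff_scaleRoots]
  exact (Dvd.dvd.mul_left (dvd_pow_self b (by omega)) _).mul_right _

lemma dvd_leadingCoeff_pow_of_dvd {g : ℤ[X]} {a b D : ℤ} (hab : IsCoprime a b)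
    (h1 : D ∣ (g.scaleRoots b).eval a) (h2 : D ∣ b ^ g.natDegree) :
    D ∣ g.leadingCoeff ^ g.natDegree := by
  obtain ⟨r, hr⟩ := dvd_eval_scaleRoots_sub (g := g) a b
  have hDa : IsCoprime D ((a ^ g.natDegree) ^ g.natDegree) :=
    (IsCoprime.of_isCoprime_of_dvd_left hab.symm.pow_left h2).pow_right.pow_right
  refine hDa.dvd_of_dvd_mul_right ?_
  rw [← mul_pow]
  have h3 := sub_dvd_pow_sub_pow (g.leadingCoeff * a ^ g.natDegree) (-(b * r)) g.natDegree
  have h4 : g.leadingCoeff * a ^ g.natDegree - -(b * r) = (g.scaleRoots b).eval a := by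
    rw [← hr]
    ring
  rw [h4] at h3
  have h5 : D ∣ (-(b * r)) ^ g.natDegree := by
    rw [← mul_neg, mul_pow]
    exact h2.mul_right _
  simpa using dvd_add (h1.trans h3) h5

lemma exists_abs_logHeight₁_eval_sub_le {g : ℤ[X]} (hg : g ≠ 0) :
    ∃ C : ℝ, 0 ≤ C ∧ ∀ x : ℚ,
      logHeight₁ ((g.map (Int.castRingHom ℚ)).eval x) ≤ g.natDegree * logHeight₁ x + C ∧
      g.natDegree * logHeight₁ x - C ≤ logHeight₁ ((g.map (Int.castRingHom ℚ)).eval x) := by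
  obtain ⟨A, hA1, hA⟩ := exists_max_one_abs_eval_bounds hg
  set d := g.natDegree with hd
  set U : ℝ := |(g.leadingCoeff : ℝ)| ^ d with hU
  have hU1 : 1 ≤ U := by
    refine one_le_pow₀ ?_
    exact_mod_cast Int.one_le_abs (leadingCoeff_ne_zero.2 hg)
  refine ⟨Real.log (A * U), Real.log_nonneg (by nlinarith), fun x => ?_⟩
  set y : ℚ := (g.map (Int.castRingHom ℚ)).eval x with hy
  have hxd : (x.den : ℚ) ≠ 0 := by exact_mod_cast x.den_nz
  have hP : (((g.scaleRoots x.den).eval x.num : ℤ) : ℚ) = (x.den : ℚ) ^ d * y := by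
    have h := scaleRoots_eval₂_mul (p := g) (Int.castRingHom ℚ) x (x.den : ℤ)
    have h2 : Int.castRingHom ℚ (x.den : ℤ) * x = Int.castRingHom ℚ x.num := by
      simp [mul_comm, Rat.mul_den_eq_num]
    rw [h2, eval₂_at_apply] at h
    simpa [hy, eval_map] using h
  obtain ⟨D, hD1, hD2⟩ := Rat.num_den_mk (q := y) (n := (g.scaleRoots x.den).eval x.num)
    (d := (x.den : ℤ) ^ d) (pow_ne_zero _ (by exact_mod_cast x.den_nz)) (by
      rw [Rat.divInt_eq_div, hP]
      push_cast
      rw [mul_div_cancel_left₀ _ (pow_ne_zero _ hxd)])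
  have hDU : D ∣ g.leadingCoeff ^ d :=
    dvd_leadingCoeff_pow_of_dvd (b := x.den) (Rat.isCoprime_num_den x) (Dvd.intro _ hD1.symm)
      (Dvd.intro _ hD2.symm)
  have hDle : |(D : ℝ)| ≤ U := by
    have := Int.le_of_dvd (abs_pos.2 (pow_ne_zero _ (leadingCoeff_ne_zero.2 hg)))
      ((abs_dvd_abs _ _).2 hDU)
    rw [abs_pow] at this
    rw [hU]
    exact_mod_cast this
  have hD0 : D ≠ 0 := by
    rintro rfl
    rw [zero_mul] at hD2
    exact pow_ne_zero _ (by exact_mod_cast x.den_nz) hD2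
  have hD1' : (1 : ℝ) ≤ |(D : ℝ)| := by exact_mod_cast Int.one_le_abs hD0
  have hden : (x.den : ℝ) ^ d = |(D : ℝ)| * y.den := by
    have h : (x.den : ℝ) ^ d = D * y.den := by exact_mod_cast hD2
    have h' := congrArg abs h
    rwa [abs_mul, abs_pow, Nat.abs_cast, Nat.abs_cast] at h'
  have hHy := mulHeight₁_rat_eq y
  have hHx : mulHeight₁ x ^ d = |(D : ℝ)| * y.den * max 1 |(x : ℝ)| ^ d := by
    rw [mulHeight₁_rat_eq x, mul_pow, hden]
  obtain ⟨hA', hA''⟩ := hA x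
  have hyd : (0 : ℝ) < y.den := by exact_mod_cast y.pos
  have h1 : mulHeight₁ y ≤ mulHeight₁ x ^ d * (A * U) := by
    rw [hHy, hHx]
    have hm : 0 ≤ max 1 |(x : ℝ)| ^ d := by positivity
    calc (y.den : ℝ) * max 1 |(y : ℝ)| ≤ y.den * (A * max 1 |(x : ℝ)| ^ d) := by gcongr
      _ = 1 * y.den * max 1 |(x : ℝ)| ^ d * (A * 1) := by ring
      _ ≤ |(D : ℝ)| * y.den * max 1 |(x : ℝ)| ^ d * (A * U) := by gcongr
  have h2 : mulHeight₁ x ^ d ≤ mulHeight₁ y * (A * U) := by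
    rw [hHy, hHx]
    calc |(D : ℝ)| * y.den * max 1 |(x : ℝ)| ^ d ≤ U * y.den * (A * max 1 |(y : ℝ)|) := by
          gcongr
      _ = _ := by ring
  have hAU : 0 < A * U := by positivity
  have hx0 := mulHeight₁_pos x
  have hy0 := mulHeight₁_pos y
  rw [logHeight₁_eq_log_mulHeight₁, logHeight₁_eq_log_mulHeight₁, ← Real.log_pow]
  constructor
  · rw [← Real.log_mul (by positivity) hAU.ne']
    exact Real.log_le_log hy0 h1
  · rw [sub_le_iff_le_add, ← Real.log_mul hy0.ne' hAU.ne']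
    exact Real.log_le_log (by positivity) h2

lemma exists_logHeight₁_gcIter_succ_bounds {g : ℤ[X]} (hg : g ≠ 0) :
    ∃ C : ℝ, 0 ≤ C ∧ ∀ (c : ℚ) (n : ℕ),
      logHeight₁ (gcIter g c (n + 1)) ≤
        g.natDegree * logHeight₁ (gcIter g c n) + (logHeight₁ c + C) ∧
      g.natDegree * logHeight₁ (gcIter g c n) - (logHeight₁ c + C) ≤
        logHeight₁ (gcIter g c (n + 1)) := by
  obtain ⟨C, hC0, hC⟩ := exists_abs_logHeight₁_eval_sub_le hg
  refine ⟨C + totalWeight ℚ * Real.log 2, by positivity, fun c n => ?_⟩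
  obtain ⟨h1, h2⟩ := hC (gcIter g c n)
  rw [gcIter_succ]
  have h3 := logHeight₁_add_le ((g.map (Int.castRingHom ℚ)).eval (gcIter g c n)) c
  have h4 := logHeight₁_sub_le ((g.map (Int.castRingHom ℚ)).eval (gcIter g c n) + c) c
  rw [add_sub_cancel_right] at h4
  constructor <;> linarith

lemma exists_logHeight₁_gcIter_le {g : ℤ[X]} (hg : IsX2Divisible g) :
    ∃ K : ℝ, 0 ≤ K ∧ ∀ (c : ℚ) (n : ℕ),
      logHeight₁ (gcIter g c n) ≤ K * (g.natDegree : ℝ) ^ n * (logHeight₁ c + 1) := by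
  obtain ⟨C, hC0, hC⟩ := exists_logHeight₁_gcIter_succ_bounds hg.ne_zero
  have hd : (2 : ℝ) ≤ g.natDegree := by exact_mod_cast hg.1
  refine ⟨C + 1, by linarith, fun c n => ?_⟩
  have hc0 := zero_le_logHeight₁ c
  have key : logHeight₁ (gcIter g c n) + (logHeight₁ c + C) ≤
      (g.natDegree : ℝ) ^ n * (logHeight₁ c + C) := by
    induction n with
    | zero => simp [gcIter_zero]
    | succ n ih =>
      have h1 := (hC c n).1
      rw [pow_succ']
      nlinarith
  have : 0 ≤ (g.natDegree : ℝ) ^ n := by positivity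
  nlinarith [mul_nonneg hC0 hc0]

lemma exists_le_logHeight₁_gcIter {g : ℤ[X]} (hg : IsX2Divisible g) (hd : 3 ≤ g.natDegree) :
    ∃ (κ : ℝ) (I : ℕ), 0 < κ ∧ ∀ c ∈ Sg g, ∀ n ≥ I,
      κ * (g.natDegree : ℝ) ^ n * (logHeight₁ c + 1) ≤ logHeight₁ (gcIter g c n) := by
  obtain ⟨C, hC0, hC⟩ := exists_logHeight₁_gcIter_succ_bounds hg.ne_zero
  have hd' : (3 : ℝ) ≤ g.natDegree := by exact_mod_cast hd
  have hstart : ∃ I : ℕ, ∀ c ∈ Sg g, ∃ i ≤ I, (logHeight₁ c + 1) / (4 * C + 4) ≤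
      logHeight₁ (gcIter g c i) - (logHeight₁ c + C) := by
    have hfin : {c : ℚ | logHeight₁ c ≤ 4 * C + 4}.Finite := Northcott.finite_le _
    have hesc : ∀ c ∈ Sg g, ∃ i, 2 * (logHeight₁ c + 1) + C ≤ logHeight₁ (gcIter g c i) := by
      intro c hc
      by_contra! h
      refine hc ((Northcott.finite_le (h := logHeight₁ (K := ℚ))
        (2 * (logHeight₁ c + 1) + C)).subset ?_)
      rintro _ ⟨n, rfl⟩
      exact (h (n + 1)).le
    choose! i hi using hesc
    obtain ⟨I, hI⟩ := (hfin.image i).bddAbove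
    refine ⟨max I 2, fun c hc => ?_⟩
    have hc0 := zero_le_logHeight₁ c
    rcases le_total (logHeight₁ c) (4 * C + 4) with hcC | hcC
    · refine ⟨i c, (hI ⟨c, hcC, rfl⟩).trans (le_max_left _ _), ?_⟩
      have := hi c hc
      rw [div_le_iff₀ (by linarith)]
      nlinarith
    · refine ⟨2, le_max_right _ _, ?_⟩
      have h1 := (hC c 1).2
      rw [gcIter_one hg] at h1
      rw [div_le_iff₀ (by linarith)]
      have h2 : 3 * logHeight₁ c ≤ g.natDegree * logHeight₁ c := by gcongr
      have h3 : logHeight₁ c - 2 * C ≤ logHeight₁ (gcIter g c 2) - (logHeight₁ c + C) := by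
        have : logHeight₁ (gcIter g c (1 + 1)) = logHeight₁ (gcIter g c 2) := rfl
        linarith
      nlinarith
  obtain ⟨I, hI⟩ := hstart
  refine ⟨1 / (4 * C + 4) / (g.natDegree : ℝ) ^ I, I, by positivity, fun c hc n hn => ?_⟩
  obtain ⟨i, hiI, hi⟩ := hI c hc
  have hc0 := zero_le_logHeight₁ c
  obtain ⟨m, rfl⟩ := Nat.exists_eq_add_of_le (hiI.trans hn)
  have hgrow : (g.natDegree : ℝ) ^ m * ((logHeight₁ c + 1) / (4 * C + 4)) ≤
      logHeight₁ (gcIter g c (i + m)) - (logHeight₁ c + C) := by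
    clear hn
    induction m with
    | zero => simpa using hi
    | succ m ih =>
      have h1 := (hC c (i + m)).2
      rw [← add_assoc, pow_succ']
      nlinarith
  have hpow : (g.natDegree : ℝ) ^ (i + m) ≤ (g.natDegree : ℝ) ^ I * (g.natDegree : ℝ) ^ m := by
    rw [← pow_add]
    exact pow_le_pow_right₀ (by linarith) (by omega)
  calc 1 / (4 * C + 4) / (g.natDegree : ℝ) ^ I * (g.natDegree : ℝ) ^ (i + m) * (logHeight₁ c + 1)
      ≤ 1 / (4 * C + 4) / (g.natDegree : ℝ) ^ I * ((g.natDegree : ℝ) ^ I * (g.natDegree : ℝ) ^ m)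
        * (logHeight₁ c + 1) := by gcongr
    _ = (g.natDegree : ℝ) ^ m * ((logHeight₁ c + 1) / (4 * C + 4)) := by
      field_simp
    _ ≤ logHeight₁ (gcIter g c (i + m)) := by linarith

end Height

section Divisibility

variable {R : Type*} [CommRing R] (q : R[X]) (γ : R)

lemma dvd_iterate_eval_add_sub (k : ℕ) (x y : R) :
    x - y ∣ (fun x => q.eval x + γ)^[k] x - (fun x => q.eval x + γ)^[k] y := by
  induction k with
  | zero => simp
  | succ k ih =>
    rw [Function.iterate_succ_apply', Function.iterate_succ_apply', add_sub_add_right_eq_sub]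
    exact ih.trans (sub_dvd_eval_sub _ _ _)

variable {q}

lemma sq_dvd_iterate_eval_add_sub (hq : X ^ 2 ∣ q) {k : ℕ} (hk : 1 ≤ k) (x : R) :
    x ^ 2 ∣ (fun x => q.eval x + γ)^[k] x - (fun x => q.eval x + γ)^[k] 0 := by
  obtain ⟨k, rfl⟩ := Nat.exists_eq_add_of_le' hk
  rw [Function.iterate_succ_apply, Function.iterate_succ_apply]
  refine dvd_trans ?_ (dvd_iterate_eval_add_sub q γ k _ _)
  obtain ⟨r, rfl⟩ := hq
  simp

lemma iterate_eval_add_dvd_iterate_mul (hq : X ^ 2 ∣ q) {k : ℕ} (hk : 1 ≤ k) (m : ℕ) :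
    (fun x => q.eval x + γ)^[k] 0 ∣ (fun x => q.eval x + γ)^[k * m] 0 := by
  induction m with
  | zero => simp
  | succ m ih =>
    have h := sq_dvd_iterate_eval_add_sub γ hq hk ((fun x => q.eval x + γ)^[k * m] 0)
    rw [← Function.iterate_add_apply, show k + k * m = k * (m + 1) by ring] at h
    exact (dvd_sub_left (dvd_refl _)).1 (ih.trans ((dvd_pow_self _ two_ne_zero).trans h))

lemma sq_iterate_eval_add_dvd_iterate_mul_sub (hq : X ^ 2 ∣ q) {k m : ℕ} (hk : 1 ≤ k)
    (hm : 1 ≤ m) :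
    ((fun x => q.eval x + γ)^[k] 0) ^ 2 ∣
      (fun x => q.eval x + γ)^[k * m] 0 - (fun x => q.eval x + γ)^[k] 0 := by
  obtain ⟨m, rfl⟩ := Nat.exists_eq_add_of_le' hm
  have h := sq_dvd_iterate_eval_add_sub γ hq hk ((fun x => q.eval x + γ)^[k * m] 0)
  rw [← Function.iterate_add_apply, show k + k * m = k * (m + 1) by ring] at h
  exact (pow_dvd_pow_of_dvd (iterate_eval_add_dvd_iterate_mul γ hq hk m) 2).trans h

lemma iterate_eval_add_dvd_iterate_mul_add_sub (hq : X ^ 2 ∣ q) {k : ℕ} (hk : 1 ≤ k)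
    (m r : ℕ) :
    (fun x => q.eval x + γ)^[k] 0 ∣
      (fun x => q.eval x + γ)^[k * m + r] 0 - (fun x => q.eval x + γ)^[r] 0 := by
  have h := dvd_iterate_eval_add_sub q γ r ((fun x => q.eval x + γ)^[k * m] 0) 0
  rw [← Function.iterate_add_apply, sub_zero, add_comm r] at h
  exact (iterate_eval_add_dvd_iterate_mul γ hq hk m).trans h

end Divisibility

section Padic

variable {p : ℕ} [hp : Fact p.Prime]

lemma norm_eval_map_of_one_lt {g : ℤ[X]} (hd : g.natDegree ≠ 0) (hp : ¬(p : ℤ) ∣ g.leadingCoeff)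
    {x : ℚ_[p]} (hx : 1 < ‖x‖) :
    ‖(g.map (Int.castRingHom ℚ_[p])).eval x‖ = ‖x‖ ^ g.natDegree := by
  have hlead : ‖(g.leadingCoeff : ℚ_[p])‖ = 1 :=
    le_antisymm (Padic.norm_int_le_one _)
      (not_lt.1 fun h => hp ((Padic.norm_intCast_lt_one_iff).1 h))
  rw [eval_map, eval₂_eq_sum_range, Finset.sum_range_succ]
  have hlt : ‖∑ i ∈ Finset.range g.natDegree,
      (Int.castRingHom ℚ_[p]) (g.coeff i) * x ^ i‖ < ‖x‖ ^ g.natDegree := by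
    have hne : (Finset.range g.natDegree).Nonempty := by
      rw [Finset.nonempty_range_iff]
      exact hd
    obtain ⟨i, hi, hle⟩ := IsUltrametricDist.exists_norm_finsetSum_le_of_nonempty hne
      fun i => (Int.castRingHom ℚ_[p]) (g.coeff i) * x ^ i
    refine hle.trans_lt ?_
    rw [norm_mul, norm_pow]
    calc ‖(Int.castRingHom ℚ_[p]) (g.coeff i)‖ * ‖x‖ ^ i ≤ 1 * ‖x‖ ^ i := by
          gcongr
          exact Padic.norm_int_le_one _
      _ < ‖x‖ ^ g.natDegree := by
          rw [one_mul]
          exact pow_lt_pow_right₀ hx (Finset.mem_range.1 hi)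
  have htop : ‖(Int.castRingHom ℚ_[p]) (g.coeff g.natDegree) * x ^ g.natDegree‖ =
      ‖x‖ ^ g.natDegree := by
    rw [norm_mul, norm_pow, coeff_natDegree, eq_intCast, hlead, one_mul]
  rw [IsUltrametricDist.norm_add_eq_max_of_norm_ne_norm (by rw [htop]; exact hlt.ne), htop,
    max_eq_right hlt.le]

lemma cast_gcIter_succ (g : ℤ[X]) (c : ℚ) (n : ℕ) :
    ((gcIter g c (n + 1) : ℚ) : ℚ_[p]) =
      (g.map (Int.castRingHom ℚ_[p])).eval ((gcIter g c n : ℚ) : ℚ_[p]) + (c : ℚ_[p]) := by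
  rw [gcIter_succ, Rat.cast_add]
  congr 1
  have h := hom_eval₂ g (Int.castRingHom ℚ) (Rat.castHom ℚ_[p]) (gcIter g c n)
  rw [eval_map, eval_map]
  simpa [RingHom.ext_int ((Rat.castHom ℚ_[p]).comp (Int.castRingHom ℚ)) (Int.castRingHom ℚ_[p])]
    using h

lemma one_lt_norm_gcIter {g : ℤ[X]} (hg : IsX2Divisible g) (hp : ¬(p : ℤ) ∣ g.leadingCoeff)
    {c : ℚ} (hc : 1 < ‖(c : ℚ_[p])‖) {n : ℕ} (hn : 1 ≤ n) :
    ‖(c : ℚ_[p])‖ ≤ ‖((gcIter g c n : ℚ) : ℚ_[p])‖ := by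
  induction n, hn using Nat.le_induction with
  | base => rw [gcIter_one hg]
  | succ n hn ih =>
    have hx := hc.trans_le ih
    have hpow : ‖((gcIter g c n : ℚ) : ℚ_[p])‖ < ‖((gcIter g c n : ℚ) : ℚ_[p])‖ ^ g.natDegree := by
      conv_lhs => rw [← pow_one ‖((gcIter g c n : ℚ) : ℚ_[p])‖]
      exact pow_lt_pow_right₀ hx hg.1
    rw [← norm_eval_map_of_one_lt (by have := hg.1; omega) hp hx] at hpow
    have hlt := ih.trans_lt hpow
    rw [cast_gcIter_succ, IsUltrametricDist.norm_add_eq_max_of_norm_ne_norm hlt.ne',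
      max_eq_left hlt.le]
    exact hlt.le

lemma padicValRat_pos_iff_norm_lt_one {x : ℚ} (hx : x ≠ 0) :
    0 < padicValRat p x ↔ ‖(x : ℚ_[p])‖ < 1 := by
  have hp1 : (1 : ℝ) < p := by exact_mod_cast hp.out.one_lt
  rw [Padic.eq_padicNorm, padicNorm.eq_zpow_of_nonzero hx]
  push_cast
  rw [zpow_lt_one_iff_right₀ hp1]
  simp

lemma padicValRat_eq_of_norm_eq {x y : ℚ} (hx : x ≠ 0) (hy : y ≠ 0)
    (h : ‖(x : ℚ_[p])‖ = ‖(y : ℚ_[p])‖) : padicValRat p x = padicValRat p y := by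
  have hp1 : (1 : ℝ) < p := by exact_mod_cast hp.out.one_lt
  rw [Padic.eq_padicNorm, Padic.eq_padicNorm, padicNorm.eq_zpow_of_nonzero hx,
    padicNorm.eq_zpow_of_nonzero hy] at h
  push_cast at h
  have := zpow_right_injective₀ (by linarith) hp1.ne' h
  simpa using this

/-- A prime of good reduction dividing a term without being primitive there occurs to the same
power in a term of at most half the index. -/
lemma exists_padicValRat_gcIter_eq {g : ℤ[X]} (hg : IsX2Divisible g)
    (hpg : ¬(p : ℤ) ∣ g.leadingCoeff) {c : ℚ} (h0 : ∀ n, 1 ≤ n → gcIter g c n ≠ 0) {n : ℕ}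
    (hn : 0 < padicValRat p (gcIter g c n))
    (hnp : ∃ k, 1 ≤ k ∧ k < n ∧ 0 < padicValRat p (gcIter g c k)) :
    ∃ k, 1 ≤ k ∧ k ≤ n / 2 ∧ padicValRat p (gcIter g c k) = padicValRat p (gcIter g c n) := by
  classical
  obtain ⟨k₀, hk₀⟩ := hnp
  have hn1 : 1 ≤ n := by omega
  have hc : ‖(c : ℚ_[p])‖ ≤ 1 := by
    by_contra! hc
    have h1 := one_lt_norm_gcIter hg hpg hc hn1
    have h2 := (padicValRat_pos_iff_norm_lt_one (h0 n hn1)).1 hn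
    linarith
  set γ : ℤ_[p] := ⟨c, hc⟩ with hγ
  set G : ℤ_[p][X] := g.map (Int.castRingHom ℤ_[p]) with hG
  have hGX : X ^ 2 ∣ G := by
    have := map_dvd (mapRingHom (Int.castRingHom ℤ_[p])) hg.X_sq_dvd
    simpa using this
  set α : ℕ → ℤ_[p] := fun n => (fun x => G.eval x + γ)^[n] 0 with hα
  have hαa : ∀ n, ((α n : ℤ_[p]) : ℚ_[p]) = ((gcIter g c n : ℚ) : ℚ_[p]) := by
    intro n
    induction n with
    | zero => simp [hα, gcIter_zero]
    | succ n ih =>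
      have h1 : α (n + 1) = G.eval (α n) + γ := Function.iterate_succ_apply' _ _ _
      have h2 := hom_eval₂ g (Int.castRingHom ℤ_[p]) (PadicInt.Coe.ringHom (p := p)) (α n)
      rw [h1, cast_gcIter_succ, ← ih, PadicInt.coe_add, hG, eval_map, eval_map]
      congr 1
  have hnorm : ∀ n, ‖α n‖ = ‖((gcIter g c n : ℚ) : ℚ_[p])‖ := fun n => by
    rw [← hαa, PadicInt.norm_def]
  have hval : ∀ n, 1 ≤ n → (0 < padicValRat p (gcIter g c n) ↔ ‖α n‖ < 1) := fun n hn => by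
    rw [hnorm, padicValRat_pos_iff_norm_lt_one (h0 n hn)]
  have hex : ∃ k, 1 ≤ k ∧ k < n ∧ 0 < padicValRat p (gcIter g c k) := ⟨k₀, hk₀⟩
  obtain ⟨hk1, hkn, hk⟩ := Nat.find_spec hex
  have hmin : ∀ m < Nat.find hex, ¬(1 ≤ m ∧ m < n ∧ 0 < padicValRat p (gcIter g c m)) :=
    fun m hm => Nat.find_min hex hm
  set k := Nat.find hex
  have hkα := (hval k hk1).1 hk
  have hdiv := Nat.div_add_mod n k
  have hlt : n % k < k := Nat.mod_lt _ hk1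
  have hmod : n % k = 0 := by
    by_contra hr
    have hr1 : 1 ≤ n % k := by omega
    refine hmin _ hlt ⟨hr1, by omega, (hval _ hr1).2 ?_⟩
    have h1 := iterate_eval_add_dvd_iterate_mul_add_sub γ hGX hk1 (n / k) (n % k)
    rw [hdiv] at h1
    have hpk : (p : ℤ_[p]) ∣ α k := PadicInt.norm_lt_one_iff_dvd _ |>.1 hkα
    have hpn : (p : ℤ_[p]) ∣ α n := PadicInt.norm_lt_one_iff_dvd _ |>.1 ((hval n hn1).1 hn)
    exact PadicInt.norm_lt_one_iff_dvd _ |>.2 ((dvd_sub_right hpn).1 (hpk.trans h1))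
  have hnk : k * (n / k) = n := by omega
  have hq2 : 2 ≤ n / k := by
    by_contra! h
    interval_cases n / k <;> omega
  refine ⟨k, hk1, ?_, ?_⟩
  · rw [Nat.le_div_iff_mul_le two_pos]
    calc k * 2 ≤ k * (n / k) := Nat.mul_le_mul_left _ hq2
      _ = n := hnk
  · refine padicValRat_eq_of_norm_eq (h0 k hk1) (h0 n hn1) ?_
    rw [← hnorm, ← hnorm]
    have h1 := sq_iterate_eval_add_dvd_iterate_mul_sub γ hGX hk1 (show 1 ≤ n / k by omega)
    rw [hnk] at h1
    obtain ⟨t, ht⟩ := h1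
    have hαk : 0 < ‖α k‖ := by
      rw [hnorm, norm_pos_iff]
      exact_mod_cast h0 k hk1
    have hlt : ‖α n - α k‖ < ‖α k‖ := by
      change α n - α k = α k ^ 2 * t at ht
      rw [ht, norm_mul, norm_pow]
      have := PadicInt.norm_le_one t
      have h0 := norm_nonneg t
      nlinarith
    have h2 : α n = α k + (α n - α k) := by ring
    rw [h2, PadicInt.norm_add_eq_max_of_ne hlt.ne', max_eq_left hlt.le]

end Padic

section Zsigmondy

open Height

lemma gcIter_ne_zero_of_mem_Sg {g : ℤ[X]} {c : ℚ} (hc : c ∈ Sg g) {n : ℕ} (hn : 1 ≤ n) :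
    gcIter g c n ≠ 0 := by
  intro h
  have hper : Function.IsPeriodicPt (fun x : ℚ => (g.map (Int.castRingHom ℚ)).eval x + c) n 0 := h
  refine hc (((Finset.range n).finite_toSet.image (gcIter g c)).subset ?_)
  rintro _ ⟨k, rfl⟩
  exact ⟨(k + 1) % n, by simpa using Nat.mod_lt _ hn, hper.iterate_mod_apply (k + 1)⟩

lemma exp_neg_logHeight₁_le_abs {x : ℚ} (hx : x ≠ 0) :
    Real.exp (-logHeight₁ x) ≤ |(x : ℝ)| := by
  have hx' : (0 : ℝ) < |(x : ℝ)| := abs_pos.2 (by exact_mod_cast hx)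
  have hd : (1 : ℝ) ≤ (x⁻¹).den := by exact_mod_cast (x⁻¹).pos
  rw [← logHeight₁_inv, logHeight₁_eq_log_mulHeight₁, Real.exp_neg,
    Real.exp_log (mulHeight₁_pos _), inv_le_comm₀ (mulHeight₁_pos _) hx', mulHeight₁_rat_eq]
  calc |(x : ℝ)|⁻¹ = |((x⁻¹ : ℚ) : ℝ)| := by rw [Rat.cast_inv, abs_inv]
    _ ≤ 1 * max 1 |((x⁻¹ : ℚ) : ℝ)| := by rw [one_mul]; exact le_max_right _ _
    _ ≤ _ := by gcongr

lemma exp_neg_logHeight₁_le_padicNorm {p : ℕ} [hp : Fact p.Prime] {x : ℚ} (hx : x ≠ 0) :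
    Real.exp (-logHeight₁ x) ≤ (padicNorm p x : ℝ) := by
  have hA : 0 < x.num.natAbs := Int.natAbs_pos.2 (Rat.num_ne_zero.2 hx)
  have hA' : (0 : ℝ) < x.num.natAbs := by exact_mod_cast hA
  have hp0 : (0 : ℝ) < p := by exact_mod_cast hp.out.pos
  have hp1 : (1 : ℝ) < p := by exact_mod_cast hp.out.one_lt
  have hpow : (p : ℝ) ^ padicValNat p x.num.natAbs ≤ x.num.natAbs := by
    exact_mod_cast Nat.le_of_dvd hA pow_padicValNat_dvd
  rw [Rat.logHeight₁_eq_log_max, Real.exp_neg, padicNorm.eq_zpow_of_nonzero hx]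
  push_cast
  rw [Real.exp_log (lt_max_of_lt_left hA'), zpow_neg]
  refine inv_anti₀ (zpow_pos hp0 _) ((le_trans ?_ hpow).trans (le_max_left _ _))
  rw [← zpow_natCast]
  refine zpow_le_zpow_right₀ hp1.le ?_
  rw [padicValRat, padicValInt]
  omega

/-- Outside a bounded number of indices, the terms of the sequence are not very close to `0` at
the archimedean place and at finitely many given primes. -/
lemma exists_card_le_forall_exp_le_abs_and_padicNorm {g : ℤ[X]} (hg : IsX2Divisible g)
    (S : Finset ℕ) (hS : ∀ p ∈ S, p.Prime) {δ : ℝ} (hδ : 0 < δ) :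
    ∃ M : ℕ, ∀ c ∈ Sg g, ∃ F : Finset ℕ, F.card ≤ M ∧ ∀ n, 1 ≤ n → n ∉ F →
      Real.exp (-(δ * (g.natDegree : ℝ) ^ n * (logHeight₁ c + 1))) ≤ |(gcIter g c n : ℝ)| ∧
      ∀ p ∈ S, Real.exp (-(δ * (g.natDegree : ℝ) ^ n * (logHeight₁ c + 1))) ≤
        (padicNorm p (gcIter g c n) : ℝ) := by
  classical
  obtain ⟨K, -, hK⟩ := exists_logHeight₁_gcIter_le hg
  have hb : (1 : ℝ) < g.natDegree := by exact_mod_cast hg.1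
  have hT (c : ℚ) : 1 ≤ logHeight₁ c + 1 := by linarith [zero_le_logHeight₁ c]
  obtain ⟨M₀, hM₀⟩ :=
    exists_card_le_forall_exp_le_abv_gcIter Rat.AbsoluteValue.real hg hb K hδ
  have hfin : ∀ p, ∃ M : ℕ, p ∈ S → ∀ c ∈ Sg g, ∃ F : Finset ℕ, F.card ≤ M ∧
      ∀ n, 1 ≤ n → n ∉ F → Real.exp (-(δ * (g.natDegree : ℝ) ^ n * (logHeight₁ c + 1))) ≤
        (padicNorm p (gcIter g c n) : ℝ) := by
    intro p
    by_cases hp : p ∈ S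
    · have : Fact p.Prime := ⟨hS p hp⟩
      obtain ⟨M, hM⟩ :=
        exists_card_le_forall_exp_le_abv_gcIter (Rat.AbsoluteValue.padic p) hg hb K hδ
      refine ⟨M, fun _ c hc => hM c _ (hT c) fun n hn => ?_⟩
      refine le_trans ?_ (exp_neg_logHeight₁_le_padicNorm (gcIter_ne_zero_of_mem_Sg hc hn))
      exact Real.exp_le_exp.2 (neg_le_neg (hK c n))
    · exact ⟨0, fun h => absurd h hp⟩
  choose M hM using hfin
  refine ⟨M₀ + ∑ p ∈ S, M p, fun c hc => ?_⟩
  obtain ⟨F₀, hF₀, hF₀'⟩ := hM₀ c _ (hT c) fun n hn => by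
    rw [Rat.AbsoluteValue.real_eq_abs, Rat.cast_abs]
    refine le_trans ?_ (exp_neg_logHeight₁_le_abs (gcIter_ne_zero_of_mem_Sg hc hn))
    exact Real.exp_le_exp.2 (neg_le_neg (hK c n))
  have hF : ∀ p, ∃ F : Finset ℕ, p ∈ S → F.card ≤ M p ∧
      ∀ n, 1 ≤ n → n ∉ F → Real.exp (-(δ * (g.natDegree : ℝ) ^ n * (logHeight₁ c + 1))) ≤
        (padicNorm p (gcIter g c n) : ℝ) := by
    intro p
    by_cases hp : p ∈ S
    · obtain ⟨F, hF⟩ := hM p hp c hc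
      exact ⟨F, fun _ => hF⟩
    · exact ⟨∅, fun h => absurd h hp⟩
  choose F hF using hF
  refine ⟨F₀ ∪ S.biUnion F, ?_, fun n hn hnF => ?_⟩
  · refine (Finset.card_union_le _ _).trans (add_le_add hF₀ (Finset.card_biUnion_le.trans ?_))
    exact Finset.sum_le_sum fun p hp => (hF p hp).1
  · rw [Finset.mem_union, Finset.mem_biUnion, not_or] at hnF
    refine ⟨?_, fun p hp => (hF p hp).2 n hn fun h => hnF.2 ⟨p, hp, h⟩⟩
    have := hF₀' n hn hnF.1
    rwa [Rat.AbsoluteValue.real_eq_abs, Rat.cast_abs] at this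

lemma padicValRat_eq_factorization_of_dvd {p : ℕ} (hp : p.Prime) {x : ℚ}
    (hpx : p ∣ x.num.natAbs) : padicValRat p x = x.num.natAbs.factorization p := by
  have hden : ¬p ∣ x.den := fun h =>
    hp.one_lt.ne' (Nat.dvd_one.1 (x.reduced ▸ Nat.dvd_gcd hpx h))
  rw [padicValRat, padicValInt, padicValNat.eq_zero_of_not_dvd hden, Nat.factorization_def _ hp]
  simp

lemma pow_factorization_dvd_of_padicValRat_eq {p : ℕ} (hp : p.Prime) {x y : ℚ} (hy : y ≠ 0)
    (hpx : p ∣ x.num.natAbs) (hxy : padicValRat p y = padicValRat p x) :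
    p ^ x.num.natAbs.factorization p ∣ y.num.natAbs := by
  have : Fact p.Prime := ⟨hp⟩
  rw [padicValRat_eq_factorization_of_dvd hp hpx] at hxy
  have hA : y.num.natAbs ≠ 0 := Int.natAbs_ne_zero.2 (Rat.num_ne_zero.2 hy)
  rw [padicValNat_dvd_iff_le hA]
  rw [padicValRat, padicValInt] at hxy
  omega

lemma log_natAbs_num_le_logHeight₁ (x : ℚ) : Real.log x.num.natAbs ≤ logHeight₁ x := by
  rcases Nat.eq_zero_or_pos x.num.natAbs with h | h
  · rw [h]
    simpa using zero_le_logHeight₁ x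
  · rw [Rat.logHeight₁_eq_log_max]
    exact Real.log_le_log (by exact_mod_cast h) (by exact_mod_cast le_max_left _ _)

lemma logHeight₁_le_log_natAbs_num_add {x : ℚ} (hx : x ≠ 0) {E : ℝ} (hE : 0 ≤ E)
    (h : Real.exp (-E) ≤ |(x : ℝ)|) : logHeight₁ x ≤ Real.log x.num.natAbs + E := by
  have hA : (0 : ℝ) < x.num.natAbs := by
    exact_mod_cast Int.natAbs_pos.2 (Rat.num_ne_zero.2 hx)
  have hd : (0 : ℝ) < x.den := by exact_mod_cast x.pos
  rw [Rat.logHeight₁_eq_log_max]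
  push_cast
  rw [Real.log_le_iff_le_exp (lt_max_of_lt_left hA), Real.exp_add, Real.exp_log hA]
  refine max_le (le_mul_of_one_le_right hA.le (Real.one_le_exp hE)) ?_
  rw [Rat.cast_def, abs_div, Nat.abs_cast, ← Int.cast_abs, ← Nat.cast_natAbs, Real.exp_neg,
    le_div_iff₀ hd, inv_mul_le_iff₀ (Real.exp_pos _)] at h
  rw [mul_comm]
  exact_mod_cast h

/-- An index without primitive prime divisor has small height, unless the term is close to `0`
at the archimedean place or at a prime dividing the leading coefficient. -/
lemma logHeight₁_gcIter_le_of_mem_Zsig {g : ℤ[X]} (hg : IsX2Divisible g) {c : ℚ}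
    (h0 : ∀ n, 1 ≤ n → gcIter g c n ≠ 0) {n : ℕ} (hn : n ∈ Zsig g c) {E : ℝ} (hE : 0 ≤ E)
    (hreal : Real.exp (-E) ≤ |(gcIter g c n : ℝ)|)
    (hpadic : ∀ p ∈ g.leadingCoeff.natAbs.primeFactors,
      Real.exp (-E) ≤ (padicNorm p (gcIter g c n) : ℝ)) :
    logHeight₁ (gcIter g c n) ≤ (g.leadingCoeff.natAbs.primeFactors.card + 1) * E +
      ∑ k ∈ Finset.Icc 1 (n / 2), logHeight₁ (gcIter g c k) := by
  classical
  obtain ⟨hn1, hprim⟩ := hn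
  set S := g.leadingCoeff.natAbs.primeFactors with hS
  set x := gcIter g c n with hx
  have hx0 : x ≠ 0 := h0 n hn1
  set A := x.num.natAbs with hA
  have hA0 : A ≠ 0 := Int.natAbs_ne_zero.2 (Rat.num_ne_zero.2 hx0)
  have hfac : (∏ p ∈ A.primeFactors with p ∈ S, p ^ A.factorization p) *
      (∏ p ∈ A.primeFactors with p ∉ S, p ^ A.factorization p) = A := by
    rw [Finset.prod_filter_mul_prod_filter_not]
    exact Nat.prod_factorization_pow_eq_self hA0
  set P := ∏ p ∈ A.primeFactors with p ∈ S, p ^ A.factorization p with hP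
  set Q := ∏ p ∈ A.primeFactors with p ∉ S, p ^ A.factorization p with hQ
  have hP0 : P ≠ 0 := fun h => hA0 (by rw [← hfac, h, zero_mul])
  have hQ0 : Q ≠ 0 := fun h => hA0 (by rw [← hfac, h, mul_zero])
  have hlogP : Real.log P ≤ S.card * E := by
    rw [hP]
    push_cast
    rw [Real.log_prod fun p hp => by
      have := (Nat.prime_of_mem_primeFactors (Finset.mem_filter.1 hp).1).pos
      positivity]
    calc ∑ p ∈ A.primeFactors with p ∈ S, Real.log ((p : ℝ) ^ A.factorization p)
        ≤ ∑ p ∈ A.primeFactors with p ∈ S, E := by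
          refine Finset.sum_le_sum fun p hp => ?_
          obtain ⟨hpA, hpS⟩ := Finset.mem_filter.1 hp
          have hpp := Nat.prime_of_mem_primeFactors hpA
          have hp0 : (0 : ℝ) < p := by exact_mod_cast hpp.pos
          have h := hpadic p hpS
          rw [padicNorm.eq_zpow_of_nonzero hx0,
            padicValRat_eq_factorization_of_dvd hpp (Nat.dvd_of_mem_primeFactors hpA)] at h
          push_cast at h
          rw [zpow_neg, zpow_natCast, Real.exp_neg,
            inv_le_inv₀ (Real.exp_pos _) (pow_pos hp0 _)] at h
          exact (Real.log_le_iff_le_exp (pow_pos hp0 _)).2 h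
      _ = ((A.primeFactors.filter (· ∈ S)).card : ℝ) * E := by
          rw [Finset.sum_const, nsmul_eq_mul]
      _ ≤ S.card * E := by
          gcongr
          exact fun p hp => (Finset.mem_filter.1 hp).2
  have hdvd : Q ∣ ∏ k ∈ Finset.Icc 1 (n / 2), (gcIter g c k).num.natAbs := by
    refine Finset.prod_dvd_of_isRelPrime (fun p hp q hq hpq => ?_) fun p hp => ?_
    · rw [Finset.mem_coe, Finset.mem_filter] at hp hq
      exact Nat.coprime_iff_isRelPrime.1 (Nat.Coprime.pow _ _
        ((Nat.coprime_primes (Nat.prime_of_mem_primeFactors hp.1)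
          (Nat.prime_of_mem_primeFactors hq.1)).2 hpq))
    · obtain ⟨hpA, hpS⟩ := Finset.mem_filter.1 hp
      have hpp := Nat.prime_of_mem_primeFactors hpA
      have hpx := Nat.dvd_of_mem_primeFactors hpA
      have : Fact p.Prime := ⟨hpp⟩
      have hpg : ¬(p : ℤ) ∣ g.leadingCoeff := fun h => hpS (Nat.mem_primeFactors.2
        ⟨hpp, Int.natCast_dvd.1 h, Int.natAbs_ne_zero.2 (leadingCoeff_ne_zero.2 hg.ne_zero)⟩)
      have hpos : 0 < padicValRat p x := by
        rw [padicValRat_eq_factorization_of_dvd hpp hpx]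
        exact_mod_cast hpp.factorization_pos_of_dvd hA0 hpx
      have hnp : ∃ k, 1 ≤ k ∧ k < n ∧ 0 < padicValRat p (gcIter g c k) := by
        by_contra! h
        exact hprim ⟨p, hpp, hpos, h⟩
      obtain ⟨k, hk1, hkn, hk⟩ := exists_padicValRat_gcIter_eq hg hpg h0 hpos hnp
      exact (pow_factorization_dvd_of_padicValRat_eq hpp (h0 k hk1) hpx hk).trans
        (Finset.dvd_prod_of_mem _ (Finset.mem_Icc.2 ⟨hk1, hkn⟩))
  have hne : ∀ k ∈ Finset.Icc 1 (n / 2), (gcIter g c k).num.natAbs ≠ 0 := fun k hk =>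
    Int.natAbs_ne_zero.2 (Rat.num_ne_zero.2 (h0 k (Finset.mem_Icc.1 hk).1))
  have hlogQ : Real.log Q ≤ ∑ k ∈ Finset.Icc 1 (n / 2), logHeight₁ (gcIter g c k) := by
    have hle : (Q : ℝ) ≤ ∏ k ∈ Finset.Icc 1 (n / 2), ((gcIter g c k).num.natAbs : ℝ) := by
      exact_mod_cast Nat.le_of_dvd (Nat.pos_of_ne_zero (Finset.prod_ne_zero_iff.2 hne)) hdvd
    refine (Real.log_le_log (by exact_mod_cast Nat.pos_of_ne_zero hQ0) hle).trans ?_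
    rw [Real.log_prod fun k hk => by exact_mod_cast hne k hk]
    exact Finset.sum_le_sum fun k _ => log_natAbs_num_le_logHeight₁ _
  have hlogA : Real.log A = Real.log P + Real.log Q := by
    rw [← Real.log_mul (by exact_mod_cast hP0) (by exact_mod_cast hQ0)]
    exact_mod_cast congrArg (fun m : ℕ => Real.log m) hfac.symm
  have := logHeight₁_le_log_natAbs_num_add hx0 hE hreal
  linarith

end Zsigmondy

/-- Theorem 1.4: for every `x²`-divisible `g ∈ ℤ[x]` of degree `d ≥ 3` there is a
constant `M_g > 0`, depending only on `g`, such that `#Z(g_c, 0) ≤ M_g` for every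
`c ∈ S_g`. -/
theorem zsigmondy_bound_x2divisible (g : ℤ[X]) (hg : IsX2Divisible g)
    (hd : 3 ≤ g.natDegree) :
    ∃ M : ℕ, 0 < M ∧ ∀ c ∈ Sg g, (Zsig g c).Finite ∧ (Zsig g c).ncard ≤ M := by
  obtain ⟨K, hK0, hK⟩ := exists_logHeight₁_gcIter_le hg
  obtain ⟨κ, I, hκ, hlow⟩ := exists_le_logHeight₁_gcIter hg hd
  set S := g.leadingCoeff.natAbs.primeFactors with hS
  set b : ℝ := (g.natDegree : ℝ) with hb
  have hb1 : 1 < b := by rw [hb]; exact_mod_cast hg.1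
  set δ : ℝ := κ / (2 * (S.card + 1)) with hδ
  have hδ0 : 0 < δ := by positivity
  obtain ⟨M, hM⟩ := exists_card_le_forall_exp_le_abs_and_padicNorm hg S
    (fun p hp => Nat.prime_of_mem_primeFactors hp) hδ0
  obtain ⟨m₀, hm₀⟩ := exists_forall_mul_succ_lt_mul_pow hb1 K (half_pos hκ)
  set N := max I (2 * m₀) with hN
  refine ⟨N + M + 1, Nat.succ_pos _, fun c hc => ?_⟩
  obtain ⟨F, hFM, hF⟩ := hM c hc
  set T : ℝ := Height.logHeight₁ c + 1 with hT
  have hT1 : 1 ≤ T := by linarith [Height.zero_le_logHeight₁ c]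
  have hsub : Zsig g c ⊆ (Finset.range N ∪ F : Finset ℕ) := by
    intro n hn
    by_contra hnF
    rw [Finset.mem_coe, Finset.mem_union, Finset.mem_range, not_or, not_lt, hN, max_le_iff] at hnF
    obtain ⟨⟨hnI, hnm⟩, hnF⟩ := hnF
    obtain ⟨hreal, hpadic⟩ := hF n hn.1 hnF
    have hup := logHeight₁_gcIter_le_of_mem_Zsig hg
      (fun n hn => gcIter_ne_zero_of_mem_Sg hc hn) hn (by positivity) hreal hpadic
    have hlo := hlow c hc n hnI
    have hsum : ∑ k ∈ Finset.Icc 1 (n / 2), Height.logHeight₁ (gcIter g c k) ≤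
        (n / 2 : ℕ) * (K * b ^ (n / 2) * T) := by
      refine (Finset.sum_le_card_nsmul _ _ (K * b ^ (n / 2) * T) fun k hk => ?_).trans_eq ?_
      · refine (hK c k).trans ?_
        have hkn := (Finset.mem_Icc.1 hk).2
        gcongr
        exact hb1.le
      · simp
    have hδκ : (S.card + 1) * (δ * b ^ n * T) = κ / 2 * b ^ n * T := by
      rw [hδ]
      field_simp
    have hm := hm₀ (n / 2) (by omega)
    have hpow : b ^ (n / 2) * b ^ (n / 2) ≤ b ^ n := by
      rw [← pow_add]
      exact pow_le_pow_right₀ hb1.le (by omega)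
    have hbp : 0 < b ^ (n / 2) := by positivity
    have hlt : (n / 2 : ℕ) * (K * b ^ (n / 2) * T) < κ / 2 * b ^ n * T := by
      calc (n / 2 : ℕ) * (K * b ^ (n / 2) * T)
          ≤ (K * ((n / 2 : ℕ) + 1)) * (b ^ (n / 2) * T) := by
            have : 0 ≤ K * (b ^ (n / 2) * T) := by positivity
            linarith
        _ < (κ / 2 * b ^ (n / 2)) * (b ^ (n / 2) * T) := by gcongr
        _ = κ / 2 * (b ^ (n / 2) * b ^ (n / 2)) * T := by ring
        _ ≤ κ / 2 * b ^ n * T := by gcongr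
    linarith
  refine ⟨(Finset.finite_toSet _).subset hsub, ?_⟩
  calc (Zsig g c).ncard ≤ ((Finset.range N ∪ F : Finset ℕ) : Set ℕ).ncard :=
        Set.ncard_le_ncard hsub (Finset.finite_toSet _)
    _ = (Finset.range N ∪ F).card := Set.ncard_coe_finset _
    _ ≤ (Finset.range N).card + F.card := Finset.card_union_le _ _
    _ ≤ N + M + 1 := by
        rw [Finset.card_range]
        omega
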